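/- Let G be a word-hyperbolic group with a marked finite generating set A, and let H ≤ G be a quasiconvex subgroup. Then the relative Cayley graph Y = Γ(G/H, A), equipped with its simplicial metric, is a Gromov-hyperbolic geodesic metric space. -/

import Mathlib

/-! ## Words over a marked generating set and word metrics -/

/-- Evaluation of a word in the letters `A × Bool` (a letter together with a sign,
`true` = the letter itself, `false` = its inverse) under a marking `π : A → G`. -/
def evalWord {A G : Type*} [Group G] (π : A → G) (w : List (A × Bool)) : G :=
  (w.map fun p => if p.2 then π p.1 else (π p.1)⁻¹).prod

/-- The word length `|g|_X` of `g ∈ G` with respect to the marked generating set `π : A → G`. -/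
noncomputable def wordLen {A G : Type*} [Group G] (π : A → G) (g : G) : ℕ :=
  sInf {n | ∃ w : List (A × Bool), w.length = n ∧ evalWord π w = g}

/-- The word metric `d_X` on the Cayley graph `X = Γ(G,A)` (restricted to vertices). -/
noncomputable def dX {A G : Type*} [Group G] (π : A → G) (g₁ g₂ : G) : ℕ :=
  wordLen π (g₁⁻¹ * g₂)

/-! ## Discrete geodesics, paths, near-geodesics, thinness, trimness -/

/-- A (discrete) geodesic from `x` to `y` in a graph-like metric `d`:
a sequence of vertices `γ 0 = x, …, γ (d x y) = y` with `d (γ i) (γ j) = |i - j|`. -/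
def IsDiscGeodesic {X : Type*} (d : X → X → ℕ) (x y : X) (γ : ℕ → X) : Prop :=
  γ 0 = x ∧ γ (d x y) = y ∧
    ∀ i j, i ≤ d x y → j ≤ d x y → d (γ i) (γ j) = Nat.dist i j

/-- A discrete edge-path of length `n`: consecutive vertices at distance at most `1`. -/
def IsDiscPath {X : Type*} (d : X → X → ℕ) (γ : ℕ → X) (n : ℕ) : Prop :=
  ∀ i < n, d (γ i) (γ (i + 1)) ≤ 1

/-- A near-geodesic from `x` to `y`: a path `p₁ p' p₂` where `p'` is geodesic and the
initial and terminal segments `p₁, p₂` have length at most `1`. -/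
def IsNearGeodesicPath {X : Type*} (d : X → X → ℕ) (x y : X) (γ : ℕ → X) (n : ℕ) : Prop :=
  γ 0 = x ∧ γ n = y ∧ IsDiscPath d γ n ∧
    ∃ a b : ℕ, a ≤ 1 ∧ b ≤ 1 ∧ a + b ≤ n ∧
      ∀ i j, a ≤ i → i ≤ j → j + b ≤ n → d (γ i) (γ j) = j - i

/-- All geodesic triangles of `(X,d)` are `δ`-thin: every side is contained in the closed
`δ`-neighbourhood of the union of the other two sides. -/
def DiscThinTriangles {X : Type*} (d : X → X → ℕ) (δ : ℝ) : Prop :=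
  ∀ x y z (γ₁ γ₂ γ₃ : ℕ → X),
    IsDiscGeodesic d x y γ₁ → IsDiscGeodesic d y z γ₂ → IsDiscGeodesic d z x γ₃ →
    ∀ i ≤ d x y, ∃ j,
      (j ≤ d y z ∧ (d (γ₁ i) (γ₂ j) : ℝ) ≤ δ) ∨
      (j ≤ d z x ∧ (d (γ₁ i) (γ₃ j) : ℝ) ≤ δ)

/-- All geodesic bigons of `(X,d)` are `δ`-thin: each side is contained in the closed
`δ`-neighbourhood of the other. -/
def DiscThinBigons {X : Type*} (d : X → X → ℕ) (δ : ℝ) : Prop :=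
  ∀ x y (α β : ℕ → X), IsDiscGeodesic d x y α → IsDiscGeodesic d x y β →
    (∀ i ≤ d x y, ∃ j ≤ d x y, (d (α i) (β j) : ℝ) ≤ δ) ∧
    (∀ i ≤ d x y, ∃ j ≤ d x y, (d (β i) (α j) : ℝ) ≤ δ)

/-- The Gromov product `(x,y)_z` with respect to the `ℕ`-valued metric `d`. -/
noncomputable def gromovProd {X : Type*} (d : X → X → ℕ) (x y z : X) : ℝ :=
  ((d z x : ℝ) + (d z y : ℝ) - (d x y : ℝ)) / 2

/-- All geodesic triangles of `(X,d)` are `δ`-trim: two points on two sides which are at the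
same distance, at most the Gromov product `(x,y)_z`, from the common vertex `z`, are
`δ`-close (this is required for every labelling of the vertices of the triangle). -/
def DiscTrimTriangles {X : Type*} (d : X → X → ℕ) (δ : ℕ) : Prop :=
  ∀ x y z (γ₁ γ₂ : ℕ → X), IsDiscGeodesic d z x γ₁ → IsDiscGeodesic d z y γ₂ →
    ∀ i, i ≤ d z x → i ≤ d z y → (i : ℝ) ≤ gromovProd d x y z →
      d (γ₁ i) (γ₂ i) ≤ δ

/-- `S ⊆ G` is `C`-quasiconvex w.r.t. `d`: every geodesic with endpoints in `S`
stays in the closed `C`-neighbourhood of `S`. -/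
def DiscQuasiconvex {G : Type*} (d : G → G → ℕ) (S : Set G) (C : ℝ) : Prop :=
  ∀ x y (γ : ℕ → G), x ∈ S → y ∈ S → IsDiscGeodesic d x y γ →
    ∀ i ≤ d x y, ∃ h ∈ S, (d (γ i) h : ℝ) ≤ C

/-! ## The relative Cayley graph (Schreier coset graph) -/

/-- The right coset `Hg` of `g`, as a vertex of the relative Cayley graph `Γ(G/H,A)`. -/
def rcoset {G : Type*} [Group G] (H : Subgroup G) (g : G) :
    Quotient (QuotientGroup.rightRel H) :=
  Quotient.mk (QuotientGroup.rightRel H) g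

/-- Right multiplication `Hg ↦ Hga` on right cosets; this is the map tracing the
edges of the relative Cayley graph. -/
def cosetMul {G : Type*} [Group G] (H : Subgroup G)
    (x : Quotient (QuotientGroup.rightRel H)) (g : G) :
    Quotient (QuotientGroup.rightRel H) :=
  Quotient.map (· * g) (fun a b hab => by
    have hab' : b * a⁻¹ ∈ H := QuotientGroup.rightRel_apply.mp hab
    show QuotientGroup.rightRel H (a * g) (b * g)
    rw [QuotientGroup.rightRel_apply]
    simpa [mul_inv_rev, mul_assoc] using hab') x

/-- The simplicial metric `d_Y` on (the vertices of) the relative Cayley graph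
`Y = Γ(G/H, A)`: the least length of a word in the generators leading from one coset
to the other. -/
noncomputable def dY {A G : Type*} [Group G] (π : A → G) (H : Subgroup G)
    (x y : Quotient (QuotientGroup.rightRel H)) : ℕ :=
  sInf {n | ∃ w : List (A × Bool), w.length = n ∧ cosetMul H x (evalWord π w) = y}

/-! ## Integer-valued graph metrics -/

/-- The vertex metric of a connected graph: an `ℕ`-valued metric in which any two distinct
points have an intermediate point one step away from the second. -/
structure IsGraphMetric {X : Type*} (d : X → X → ℕ) : Prop where
  self : ∀ x, d x x = 0
  eq_of_zero : ∀ x y, d x y = 0 → x = y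
  symm : ∀ x y, d x y = d y x
  triangle : ∀ x y z, d x z ≤ d x y + d y z
  step : ∀ x y n, d x y = n + 1 → ∃ z, d x z = n ∧ d z y ≤ 1

/-- Gromov's four-point inequality with additive constant `k`. -/
def FourPoint {X : Type*} (d : X → X → ℕ) (k : ℕ) : Prop :=
  ∀ x y z w, d x y + d z w ≤ max (d x z + d y w) (d x w + d y z) + k

namespace IsGraphMetric

variable {X : Type*} {d : X → X → ℕ}

theorem exists_path (hd : IsGraphMetric d) (x : X) :
    ∀ n y, d x y = n → ∃ γ : ℕ → X, γ 0 = x ∧ γ n = y ∧ ∀ i < n, d (γ i) (γ (i + 1)) ≤ 1 := by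
  intro n
  induction n with
  | zero =>
    intro y hy
    exact ⟨fun _ => x, rfl, hd.eq_of_zero x y hy, fun i hi => absurd hi (Nat.not_lt_zero i)⟩
  | succ n ih =>
    intro y hy
    obtain ⟨z, hz, hzy⟩ := hd.step x y n hy
    obtain ⟨γ, h0, hn, hs⟩ := ih z hz
    refine ⟨fun i => if i ≤ n then γ i else y, by simpa using h0, by simp, fun i hi => ?_⟩
    rcases Nat.lt_or_ge i n with h | h
    · have h1 : i ≤ n := h.le
      have h2 : i + 1 ≤ n := h
      simpa [h1, h2] using hs i h
    · obtain rfl : i = n := by omega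
      simpa [hn] using hzy

theorem path_le (hd : IsGraphMetric d) {γ : ℕ → X} {n : ℕ}
    (hs : ∀ i < n, d (γ i) (γ (i + 1)) ≤ 1) (i m : ℕ) (h : i + m ≤ n) :
    d (γ i) (γ (i + m)) ≤ m := by
  induction m with
  | zero => simp [hd.self]
  | succ m ih =>
    have h1 := ih (by omega)
    have h2 := hs (i + m) (by omega)
    have h3 := hd.triangle (γ i) (γ (i + m)) (γ (i + m + 1))
    have : i + (m + 1) = i + m + 1 := by omega
    rw [this]
    omega

theorem exists_geodesic (hd : IsGraphMetric d) (x y : X) :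
    ∃ γ : ℕ → X, IsDiscGeodesic d x y γ := by
  obtain ⟨γ, h0, hn, hs⟩ := hd.exists_path x (d x y) y rfl
  have key : ∀ i m, i + m ≤ d x y → d (γ i) (γ (i + m)) = m := by
    intro i m him
    have h1 := hd.path_le hs i m him
    have h2 := hd.path_le hs 0 i (by omega)
    have h3 := hd.path_le hs (i + m) (d x y - (i + m)) (by omega)
    rw [Nat.zero_add, h0] at h2
    rw [Nat.add_sub_cancel' him, hn] at h3
    have h4 := hd.triangle x (γ i) y
    have h5 := hd.triangle (γ i) (γ (i + m)) y
    omega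
  refine ⟨γ, h0, hn, fun i j hi hj => ?_⟩
  rcases le_total i j with h | h
  · have := key i (j - i) (by omega)
    rw [Nat.add_sub_cancel' h] at this
    rw [this, Nat.dist_eq_sub_of_le h]
  · have := key j (i - j) (by omega)
    rw [Nat.add_sub_cancel' h] at this
    rw [hd.symm, this, Nat.dist_eq_sub_of_le_right h]

end IsGraphMetric

namespace IsDiscGeodesic

variable {X : Type*} {d : X → X → ℕ} {x y : X} {γ : ℕ → X}

theorem dist_left (h : IsDiscGeodesic d x y γ) {i : ℕ} (hi : i ≤ d x y) :
    d x (γ i) = i := by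
  have := h.2.2 0 i (Nat.zero_le _) hi
  rwa [h.1, Nat.dist_eq_sub_of_le (Nat.zero_le _), Nat.sub_zero] at this

theorem dist_right (h : IsDiscGeodesic d x y γ) {i : ℕ} (hi : i ≤ d x y) :
    d (γ i) y = d x y - i := by
  have := h.2.2 i (d x y) hi le_rfl
  rwa [h.2.1, Nat.dist_eq_sub_of_le hi] at this

theorem dist_succ (h : IsDiscGeodesic d x y γ) {i : ℕ} (hi : i + 1 ≤ d x y) :
    d (γ i) (γ (i + 1)) = 1 := by
  rw [h.2.2 i (i + 1) (by omega) hi, Nat.dist_eq_sub_of_le (by omega)]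
  omega

end IsDiscGeodesic

/-! ## Thin triangles and the four-point inequality -/

section Hyperbolic

variable {X : Type*} {d : X → X → ℕ}

/-- In a space with thin triangles, the distance from `w` to a geodesic `[x, y]` is at most the
Gromov product `(x, y)_w` up to an additive constant. -/
theorem exists_le_gromovProd (hd : IsGraphMetric d) {D : ℕ} (hD : DiscThinTriangles d D)
    {x y : X} {γ : ℕ → X} (hγ : IsDiscGeodesic d x y γ) (w : X) :
    ∃ i ≤ d x y, d x y + 2 * d (γ i) w ≤ d x w + d y w + 4 * D + 2 := by
  classical
  obtain ⟨α, hα⟩ := hd.exists_geodesic y w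
  obtain ⟨β, hβ⟩ := hd.exists_geodesic w x
  have thin : ∀ i ≤ d x y, i + d (γ i) w ≤ d x w + 2 * D ∨
      (d x y - i) + d (γ i) w ≤ d y w + 2 * D := by
    intro i hi
    have hxi := hγ.dist_left hi
    have hyi := hγ.dist_right hi
    obtain ⟨j, ⟨hj, hjD⟩ | ⟨hj, hjD⟩⟩ := hD x y w γ α β hγ hα hβ i hi
    · right
      have e : d (γ i) (α j) ≤ D := by exact_mod_cast hjD
      have h1 := hα.dist_left hj
      have h2 := hα.dist_right hj
      have h3 := hd.triangle (γ i) (α j) y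
      have h4 := hd.triangle (γ i) (α j) w
      have h5 := hd.symm (α j) y
      omega
    · left
      have e : d (γ i) (β j) ≤ D := by exact_mod_cast hjD
      have h1 := hβ.dist_left hj
      have h2 := hβ.dist_right hj
      have h3 := hd.triangle (γ i) (β j) x
      have h4 := hd.triangle (γ i) (β j) w
      have h5 := hd.symm (β j) w
      have h6 := hd.symm x w
      have h7 := hd.symm x (γ i)
      omega
  have ex : ∃ i, i ≤ d x y ∧ (d x y - i) + d (γ i) w ≤ d y w + 2 * D :=
    ⟨d x y, le_rfl, by rw [hγ.2.1]; omega⟩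
  obtain ⟨hi, hB⟩ := Nat.find_spec ex
  have hmin := fun m (hm : m < Nat.find ex) => Nat.find_min ex hm
  generalize Nat.find ex = i at hi hB hmin
  refine ⟨i, hi, ?_⟩
  rcases i with _ | i
  · rw [hγ.1] at hB ⊢
    omega
  · have h1 := hmin i (by omega)
    have h2 := thin i (by omega)
    have h3 := hγ.dist_succ hi
    have h4 := hd.triangle (γ (i + 1)) (γ i) w
    have h5 := hd.symm (γ (i + 1)) (γ i)
    omega

theorem DiscThinTriangles.fourPoint (hd : IsGraphMetric d) {D : ℕ}
    (hD : DiscThinTriangles d D) : FourPoint d (6 * D + 2) := by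
  intro x y z w
  obtain ⟨γ, hγ⟩ := hd.exists_geodesic x y
  obtain ⟨α, hα⟩ := hd.exists_geodesic y z
  obtain ⟨β, hβ⟩ := hd.exists_geodesic z x
  obtain ⟨i, hi, hw⟩ := exists_le_gromovProd hd hD hγ w
  have s1 := hd.symm x z
  have s2 := hd.symm z w
  have s3 := hd.symm y w
  have s4 := hd.symm x w
  obtain ⟨j, ⟨hj, hjD⟩ | ⟨hj, hjD⟩⟩ := hD x y z γ α β hγ hα hβ i hi
  · have e : d (γ i) (α j) ≤ D := by exact_mod_cast hjD
    have h1 := hα.dist_left hj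
    have h2 := hα.dist_right hj
    have h3 := hd.triangle y (α j) w
    have h4 := hd.triangle z (α j) w
    have h5 := hd.triangle (α j) (γ i) w
    have h6 := hd.symm (α j) (γ i)
    have h7 := hd.symm (α j) z
    omega
  · have e : d (γ i) (β j) ≤ D := by exact_mod_cast hjD
    have h1 := hβ.dist_left hj
    have h2 := hβ.dist_right hj
    have h3 := hd.triangle x (β j) w
    have h4 := hd.triangle z (β j) w
    have h5 := hd.triangle (β j) (γ i) w
    have h6 := hd.symm (β j) (γ i)
    have h7 := hd.symm (β j) x
    omega

/-- A point which is almost between `y` and `z` is close to any geodesic from `y` to `z`. -/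
theorem FourPoint.exists_close (hd : IsGraphMetric d) {k : ℕ} (hk : FourPoint d k)
    {y z p : X} {α : ℕ → X} (hα : IsDiscGeodesic d y z α)
    (hp : d y p + d p z ≤ d y z + k) : ∃ j ≤ d y z, d p (α j) ≤ 2 * k := by
  refine ⟨min (d y p) (d y z), min_le_right _ _, ?_⟩
  have h1 := hα.dist_left (min_le_right (d y p) (d y z))
  have h2 := hα.dist_right (min_le_right (d y p) (d y z))
  have h3 := hk p (α (min (d y p) (d y z))) y z
  have h4 := hd.symm p y
  have h5 := hd.symm (α (min (d y p) (d y z))) y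
  omega

theorem FourPoint.discThinTriangles (hd : IsGraphMetric d) {k : ℕ} (hk : FourPoint d k) :
    DiscThinTriangles d ((2 * k : ℕ) : ℝ) := by
  intro x y z γ α β hγ hα hβ i hi
  have h1 := hγ.dist_left hi
  have h2 := hγ.dist_right hi
  have h3 := hk (γ i) z x y
  have h4 := hd.symm x (γ i)
  have h5 := hd.symm y (γ i)
  have h6 := hd.symm z (γ i)
  have h7 := hd.symm z y
  rcases le_total (d (γ i) x + d z y) (d (γ i) y + d z x) with h | h
  · obtain ⟨j, hj, hj'⟩ := hk.exists_close hd (p := γ i) hβ (by omega)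
    exact ⟨j, Or.inr ⟨hj, by exact_mod_cast hj'⟩⟩
  · obtain ⟨j, hj, hj'⟩ := hk.exists_close hd (p := γ i) hα (by omega)
    exact ⟨j, Or.inl ⟨hj, by exact_mod_cast hj'⟩⟩

/-- The four-point inequality at one base point implies it everywhere. -/
theorem fourPoint_of_basepoint (hd : IsGraphMetric d) {k : ℕ} (o : X)
    (ho : ∀ x y z, d x y + d z o ≤ max (d x z + d y o) (d x o + d y z) + k) :
    FourPoint d (2 * k) := by
  intro x y z t
  have a1 := ho x y z
  have a2 := ho x y t
  have a3 := ho z t x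
  have a4 := ho z t y
  have s1 := hd.symm z x
  have s2 := hd.symm z y
  have s3 := hd.symm t x
  have s4 := hd.symm t y
  omega

/-- If `o` is a nearest point to `x` in a quasiconvex set `S`, then going from `x` to a point of
`S` through `o` is efficient up to an additive constant. -/
theorem FourPoint.add_le_of_nearest (hd : IsGraphMetric d) {k C : ℕ} (hk : FourPoint d k)
    {S : Set X} (hS : DiscQuasiconvex d S C) {o h x : X} (ho : o ∈ S) (hh : h ∈ S)
    (hx : ∀ s ∈ S, d x o ≤ d x s) : d x o + d o h ≤ d x h + 2 * (C + k + 1) := by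
  rcases Nat.lt_or_ge (d o h) (C + k + 1) with hlt | hge
  · have h1 := hd.triangle x h o
    have h2 := hd.symm o h
    omega
  · obtain ⟨γ, hγ⟩ := hd.exists_geodesic o h
    obtain ⟨s, hs, hs'⟩ := hS o h γ ho hh hγ _ hge
    have e : d (γ (C + k + 1)) s ≤ C := by exact_mod_cast hs'
    have h1 := hγ.dist_left hge
    have h2 := hγ.dist_right hge
    have h3 := hx s hs
    have h4 := hd.triangle x (γ (C + k + 1)) s
    have h5 := hk x (γ (C + k + 1)) o h
    have h6 := hd.symm (γ (C + k + 1)) o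
    omega

/-- If `x`, `y` have nearest points `o`, `h` in a quasiconvex set, then either `o` and `h` are
close, or every path from `x` to `y` essentially passes through `o` and `h`. -/
theorem FourPoint.nearest_dichotomy (hd : IsGraphMetric d) {k C : ℕ} (hk : FourPoint d k)
    {S : Set X} (hS : DiscQuasiconvex d S C) {o h x y : X} (ho : o ∈ S) (hh : h ∈ S)
    (hx : ∀ s ∈ S, d x o ≤ d x s) (hy : ∀ s ∈ S, d y h ≤ d y s) :
    d o h ≤ 4 * (C + k + 1) + k ∨ d x o + d y h ≤ d x y + (4 * (C + k + 1) + k) := by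
  have h1 := hk.add_le_of_nearest hd hS ho hh hx
  have h2 := hk.add_le_of_nearest hd hS hh ho hy
  have h3 := hk x h o y
  have h4 := hd.symm h o
  have h5 := hd.symm y o
  have h6 := hd.symm y h
  omega

end Hyperbolic

/-! ## Word metrics on transitive right actions -/

section WordMetric

variable {A G : Type*} [Group G] {π : A → G}

theorem evalWord_nil : evalWord π [] = 1 := rfl

theorem evalWord_append (u v : List (A × Bool)) :
    evalWord π (u ++ v) = evalWord π u * evalWord π v := by
  simp [evalWord]

theorem exists_evalWord_inv (w : List (A × Bool)) :
    ∃ v : List (A × Bool), v.length = w.length ∧ evalWord π v = (evalWord π w)⁻¹ := by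
  induction w with
  | nil => exact ⟨[], rfl, by simp [evalWord]⟩
  | cons p w ih =>
    obtain ⟨v, hv, hv'⟩ := ih
    refine ⟨v ++ [(p.1, !p.2)], by simp [hv], ?_⟩
    rw [evalWord_append, hv']
    rcases p with ⟨a, _ | _⟩ <;> simp [evalWord]

theorem exists_evalWord_eq (hgen : Subgroup.closure (Set.range π) = ⊤) (g : G) :
    ∃ w : List (A × Bool), evalWord π w = g := by
  have hg : g ∈ Subgroup.closure (Set.range π) := hgen ▸ Subgroup.mem_top g
  induction hg using Subgroup.closure_induction with
  | mem x hx =>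
    obtain ⟨a, rfl⟩ := hx
    exact ⟨[(a, true)], by simp [evalWord]⟩
  | one => exact ⟨[], rfl⟩
  | mul x y _ _ hx hy =>
    obtain ⟨u, rfl⟩ := hx
    obtain ⟨v, rfl⟩ := hy
    exact ⟨u ++ v, evalWord_append u v⟩
  | inv x _ hx =>
    obtain ⟨u, rfl⟩ := hx
    obtain ⟨v, -, hv⟩ := exists_evalWord_inv (π := π) u
    exact ⟨v, hv⟩

/-- The word metric of a transitive right action of a marked group is a graph metric. -/
theorem isGraphMetric_of_action {X : Type*} (hgen : Subgroup.closure (Set.range π) = ⊤)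
    (act : X → G → X) (act_one : ∀ x, act x 1 = x)
    (act_mul : ∀ x g h, act x (g * h) = act (act x g) h)
    (act_trans : ∀ x y, ∃ g, act x g = y) :
    IsGraphMetric fun x y =>
      sInf {n | ∃ w : List (A × Bool), w.length = n ∧ act x (evalWord π w) = y} := by
  have mem : ∀ x y, ∃ w : List (A × Bool),
      w.length = sInf {n | ∃ w : List (A × Bool), w.length = n ∧ act x (evalWord π w) = y} ∧
        act x (evalWord π w) = y := by
    intro x y
    obtain ⟨g, hg⟩ := act_trans x y
    obtain ⟨w, rfl⟩ := exists_evalWord_eq hgen g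
    exact Nat.sInf_mem (s := {n | ∃ w : List (A × Bool), w.length = n ∧
      act x (evalWord π w) = y}) ⟨w.length, w, rfl, hg⟩
  have le : ∀ x y (w : List (A × Bool)), act x (evalWord π w) = y →
      sInf {n | ∃ w : List (A × Bool), w.length = n ∧ act x (evalWord π w) = y} ≤ w.length :=
    fun x y w hw => Nat.sInf_le ⟨w, rfl, hw⟩
  have symm_le : ∀ x y,
      sInf {n | ∃ w : List (A × Bool), w.length = n ∧ act y (evalWord π w) = x} ≤
        sInf {n | ∃ w : List (A × Bool), w.length = n ∧ act x (evalWord π w) = y} := by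
    intro x y
    obtain ⟨w, hw, hw'⟩ := mem x y
    obtain ⟨v, hv, hv'⟩ := exists_evalWord_inv (π := π) w
    rw [← hw, ← hv]
    refine le y x v ?_
    rw [← hw', hv', ← act_mul, mul_inv_cancel, act_one]
  have triangle : ∀ x y z,
      sInf {n | ∃ w : List (A × Bool), w.length = n ∧ act x (evalWord π w) = z} ≤
        sInf {n | ∃ w : List (A × Bool), w.length = n ∧ act x (evalWord π w) = y} +
        sInf {n | ∃ w : List (A × Bool), w.length = n ∧ act y (evalWord π w) = z} := by
    intro x y z
    obtain ⟨u, hu, hu'⟩ := mem x y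
    obtain ⟨v, hv, hv'⟩ := mem y z
    rw [← hu, ← hv, ← List.length_append]
    refine le x z _ ?_
    rw [evalWord_append, act_mul, hu', hv']
  refine ⟨fun x => ?_, fun x y h => ?_, fun x y => le_antisymm (symm_le y x) (symm_le x y),
    triangle, fun x y n h => ?_⟩
  · exact Nat.le_zero.mp (le x x [] (by rw [evalWord_nil, act_one]))
  · obtain ⟨w, hw, hw'⟩ := mem x y
    have : w = [] := List.length_eq_zero_iff.mp (hw.trans h)
    rw [← hw', this, evalWord_nil, act_one]
  · obtain ⟨w, hw, hw'⟩ := mem x y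
    rw [h] at hw
    have hsplit := List.take_append_drop n w
    have hlast := le (act x (evalWord π (w.take n))) y (w.drop n)
      (by rw [← act_mul, ← evalWord_append, hsplit, hw'])
    have hinit := le x _ (w.take n) rfl
    have htri := triangle x (act x (evalWord π (w.take n))) y
    rw [List.length_drop, hw] at hlast
    rw [List.length_take, hw] at hinit
    exact ⟨act x (evalWord π (w.take n)), by omega, by omega⟩

theorem dX_eq_sInf (x y : G) :
    dX π x y = sInf {n | ∃ w : List (A × Bool), w.length = n ∧ x * evalWord π w = y} := by
  simp only [dX, wordLen, eq_inv_mul_iff_mul_eq]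

theorem isGraphMetric_dX (hgen : Subgroup.closure (Set.range π) = ⊤) :
    IsGraphMetric (dX π) := by
  have h := isGraphMetric_of_action hgen (fun x g : G => x * g) mul_one
    (fun x g h => (mul_assoc x g h).symm) (fun x y => ⟨x⁻¹ * y, mul_inv_cancel_left x y⟩)
  simpa only [← dX_eq_sInf] using h

theorem dX_mul_left (g x y : G) : dX π (g * x) (g * y) = dX π x y := by
  simp [dX, mul_assoc]

theorem dX_mul_right_eq (g x y : G) : dX π (g * x) y = dX π x (g⁻¹ * y) := by
  rw [← dX_mul_left g⁻¹, inv_mul_cancel_left]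

variable {H : Subgroup G}

theorem rcoset_surjective : Function.Surjective (rcoset H) := Quotient.mk_surjective

theorem rcoset_eq_iff {x y : G} : rcoset H x = rcoset H y ↔ ∃ h ∈ H, x = h * y := by
  have key : rcoset H x = rcoset H y ↔ y * x⁻¹ ∈ H :=
    Quotient.eq.trans QuotientGroup.rightRel_apply
  rw [key]
  constructor
  · intro hm
    exact ⟨x * y⁻¹, by simpa using H.inv_mem hm, by simp⟩
  · rintro ⟨h, hh, rfl⟩
    simpa using hh

theorem cosetMul_rcoset (x g : G) : cosetMul H (rcoset H x) g = rcoset H (x * g) := rfl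

theorem isGraphMetric_dY (hgen : Subgroup.closure (Set.range π) = ⊤) (H : Subgroup G) :
    IsGraphMetric (dY π H) := by
  refine isGraphMetric_of_action hgen (cosetMul H) (fun x => ?_) (fun x g h => ?_)
    (fun x y => ?_)
  · obtain ⟨x, rfl⟩ := rcoset_surjective x
    rw [cosetMul_rcoset, mul_one]
  · obtain ⟨x, rfl⟩ := rcoset_surjective x
    simp only [cosetMul_rcoset, mul_assoc]
  · obtain ⟨x, rfl⟩ := rcoset_surjective x
    obtain ⟨y, rfl⟩ := rcoset_surjective y
    exact ⟨x⁻¹ * y, by rw [cosetMul_rcoset, mul_inv_cancel_left]⟩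

theorem dY_le_dX (hgen : Subgroup.closure (Set.range π) = ⊤) (x y : G) {h : G} (hh : h ∈ H) :
    dY π H (rcoset H x) (rcoset H y) ≤ dX π x (h * y) := by
  obtain ⟨v, hv⟩ := exists_evalWord_eq hgen (x⁻¹ * (h * y))
  obtain ⟨w, hw, hw'⟩ := Nat.sInf_mem (s := {n | ∃ w : List (A × Bool), w.length = n ∧
    x * evalWord π w = h * y}) ⟨_, v, rfl, by rw [hv, mul_inv_cancel_left]⟩
  rw [dX_eq_sInf, ← hw]
  refine Nat.sInf_le ⟨w, rfl, ?_⟩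
  rw [cosetMul_rcoset, hw']
  exact rcoset_eq_iff.mpr ⟨h, hh, rfl⟩

theorem exists_dX_eq_dY (hgen : Subgroup.closure (Set.range π) = ⊤) (x y : G) :
    ∃ h ∈ H, dX π x (h * y) = dY π H (rcoset H x) (rcoset H y) := by
  obtain ⟨v, hv⟩ := exists_evalWord_eq hgen (x⁻¹ * y)
  obtain ⟨w, hw, hw'⟩ := Nat.sInf_mem (s := {n | ∃ w : List (A × Bool), w.length = n ∧
    cosetMul H (rcoset H x) (evalWord π w) = rcoset H y})
    ⟨_, v, rfl, by rw [cosetMul_rcoset, hv, mul_inv_cancel_left]⟩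
  rw [cosetMul_rcoset] at hw'
  obtain ⟨h, hh, he⟩ := rcoset_eq_iff.mp hw'
  refine ⟨h, hh, le_antisymm ?_ (dY_le_dX hgen x y hh)⟩
  rw [dX_eq_sInf]
  exact Nat.sInf_le ⟨w, hw, he⟩

/-- Every coset has a representative whose nearest point in `H` is the identity. -/
theorem exists_shortest_rep (hgen : Subgroup.closure (Set.range π) = ⊤)
    (a : Quotient (QuotientGroup.rightRel H)) :
    ∃ x : G, rcoset H x = a ∧ dY π H a (rcoset H 1) = dX π x 1 ∧
      ∀ h ∈ H, dX π x 1 ≤ dX π x h := by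
  obtain ⟨g, rfl⟩ := rcoset_surjective a
  obtain ⟨h, hh, he⟩ := exists_dX_eq_dY (H := H) hgen g 1
  have hx : dX π (h⁻¹ * g) 1 = dY π H (rcoset H g) (rcoset H 1) := by
    rw [dX_mul_right_eq, inv_inv, he]
  have hc : rcoset H (h⁻¹ * g) = rcoset H g := rcoset_eq_iff.mpr ⟨h⁻¹, H.inv_mem hh, rfl⟩
  refine ⟨h⁻¹ * g, hc, hx.symm, fun s hs => ?_⟩
  have := dY_le_dX hgen (h⁻¹ * g) 1 hs
  rwa [hc, mul_one, ← hx] at this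

theorem fourPoint_dY (hgen : Subgroup.closure (Set.range π) = ⊤) {k C : ℕ}
    (hk : FourPoint (dX π) k) (hC : DiscQuasiconvex (dX π) (H : Set G) C) :
    ∃ m, FourPoint (dY π H) m := by
  have hd := isGraphMetric_dX hgen
  have hdY := isGraphMetric_dY hgen H
  set M := 4 * (C + k + 1) + k with hM
  have dich : ∀ x z : G, (∀ s ∈ H, dX π x 1 ≤ dX π x s) → (∀ s ∈ H, dX π z 1 ≤ dX π z s) →
      ∀ h ∈ H, dX π h 1 ≤ M ∨ dX π x 1 + dX π z 1 ≤ dX π x (h * z) + M := by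
    intro x z hx hz h hh
    have e : ∀ s, dX π (h * z) s = dX π z (h⁻¹ * s) := dX_mul_right_eq h z
    have := hk.nearest_dichotomy hd hC (o := 1) (h := h) (x := x) (y := h * z) H.one_mem hh hx
      (fun s hs => by
        rw [e, e, inv_mul_cancel]
        exact hz _ (H.mul_mem (H.inv_mem hh) hs))
    rwa [e h, inv_mul_cancel, hd.symm 1 h] at this
  refine ⟨2 * (k + 3 * M), fourPoint_of_basepoint hdY (rcoset H 1) fun a b c => ?_⟩
  obtain ⟨x, rfl, hx, hx'⟩ := exists_shortest_rep hgen a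
  obtain ⟨y, rfl, hy, hy'⟩ := exists_shortest_rep hgen b
  obtain ⟨z, rfl, hz, hz'⟩ := exists_shortest_rep hgen c
  obtain ⟨h, hh, he⟩ := exists_dX_eq_dY (H := H) hgen x z
  obtain ⟨g, hg, he'⟩ := exists_dX_eq_dY (H := H) hgen y z
  have htri := hdY.triangle (rcoset H x) (rcoset H 1) (rcoset H y)
  have hsymm := hdY.symm (rcoset H 1) (rcoset H y)
  rcases dich x z hx' hz' h hh with h1 | h1
  · rcases dich y z hy' hz' g hg with h2 | h2
    · have h3 := dY_le_dX hgen x y (H.mul_mem hh (H.inv_mem hg))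
      have h4 := hk x (h * g⁻¹ * y) (h * z) 1
      have h5 : dX π (h * g⁻¹ * y) (h * z) = dX π y (g * z) := by
        rw [mul_assoc, dX_mul_left, dX_mul_right_eq, inv_inv]
      have h6 : dX π z 1 ≤ dX π (h * z) 1 + dX π h 1 := by
        have t := hd.triangle (h * z) 1 h
        rw [dX_mul_right_eq h z h, inv_mul_cancel] at t
        have := hd.symm 1 h
        omega
      have h7 : dX π (h * g⁻¹ * y) 1 ≤ dX π y 1 + dX π h 1 + dX π g 1 := by
        have t1 := hd.triangle (h * g⁻¹ * y) (h * g⁻¹) 1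
        have t2 := hd.triangle (h * g⁻¹) h 1
        have e1 : dX π (h * g⁻¹ * y) (h * g⁻¹) = dX π y 1 := by
          rw [dX_mul_right_eq, inv_mul_cancel]
        have e2 : dX π (h * g⁻¹) h = dX π g 1 := by
          rw [dX_mul_right_eq, inv_mul_cancel, ← dX_mul_left g, mul_inv_cancel, mul_one,
            hd.symm]
        omega
      omega
    · omega
  · omega

end WordMetric

theorem DiscThinTriangles.mono {X : Type*} {d : X → X → ℕ} {δ ε : ℝ} (hle : δ ≤ ε)
    (h : DiscThinTriangles d δ) : DiscThinTriangles d ε := by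
  intro x y z γ₁ γ₂ γ₃ h₁ h₂ h₃ i hi
  obtain ⟨j, hj⟩ := h x y z γ₁ γ₂ γ₃ h₁ h₂ h₃ i hi
  exact ⟨j, hj.imp (And.imp_right hle.trans') (And.imp_right hle.trans')⟩

theorem DiscQuasiconvex.mono {X : Type*} {d : X → X → ℕ} {S : Set X} {C C' : ℝ} (hle : C ≤ C')
    (h : DiscQuasiconvex d S C) : DiscQuasiconvex d S C' := by
  intro x y γ hx hy hγ i hi
  obtain ⟨s, hs, hs'⟩ := h x y γ hx hy hγ i hi
  exact ⟨s, hs, hs'.trans hle⟩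

/-- **Theorem 1.2.** Let `G` be a word-hyperbolic group with a marked finite generating set
`A` (given by `π : A → G` whose range generates `G`), and let `H ≤ G` be a quasiconvex
subgroup.  Then the relative Cayley graph `Y = Γ(G/H, A)`, equipped with its simplicial
metric `d_Y`, is a Gromov-hyperbolic geodesic metric space: any two vertices are joined by
a geodesic, and there is `δ' ≥ 0` such that all geodesic triangles of `Y` are `δ'`-thin. -/
theorem relative_cayley_graph_hyperbolic
    {A G : Type*} [Group G] [Fintype A] (π : A → G)
    (hgen : Subgroup.closure (Set.range π) = ⊤)
    (hhyp : ∃ δ : ℝ, 0 ≤ δ ∧ DiscThinTriangles (dX π) δ)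
    (H : Subgroup G)
    (hqc : ∃ C : ℝ, 0 < C ∧ DiscQuasiconvex (dX π) (H : Set G) C) :
    (∀ x y : Quotient (QuotientGroup.rightRel H),
        ∃ γ : ℕ → Quotient (QuotientGroup.rightRel H), IsDiscGeodesic (dY π H) x y γ) ∧
    (∃ δ' : ℝ, 0 ≤ δ' ∧ DiscThinTriangles (dY π H) δ') := by
  obtain ⟨δ, -, hδ⟩ := hhyp
  obtain ⟨C, -, hC⟩ := hqc
  have hk := (hδ.mono (Nat.le_ceil δ)).fourPoint (isGraphMetric_dX hgen)
  obtain ⟨m, hm⟩ := fourPoint_dY hgen hk (hC.mono (Nat.le_ceil C))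
  have hdY := isGraphMetric_dY hgen H
  exact ⟨hdY.exists_geodesic, _, Nat.cast_nonneg _, hm.discThinTriangles hdY⟩
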